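/- The measure π is reversible for the colored eigenvector moment flow: for every 1 ≤ i < j ≤ N and all functions f, g : {1,…,N}^{2n} → ℝ, one has Σ_{x∈Λⁿ} π(x) f(x) (𝓛_{ij} g)(x) = Σ_{x∈Λⁿ} π(x) (𝓛_{ij} f)(x) g(x); i.e. each 𝓛_{ij} is self-adjoint with respect to the inner product ⟨f,g⟩_π := Σ_{x∈Λⁿ} π(x) f(x) g(x). -/

import Mathlib

open Finset

/-- The number of particles of the configuration `x` at site `i`. -/
def cnt {N n : ℕ} (x : Fin (2 * n) → Fin N) (i : Fin N) : ℕ :=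
  (Finset.univ.filter (fun a => x a = i)).card

/-- The move `m^{ij}_{ab}`: if `x_a = x_b = i`, both particles at positions `a, b` jump to
site `j`; otherwise nothing happens. -/
def moveM {N n : ℕ} (i j : Fin N) (a b : Fin (2 * n)) (x : Fin (2 * n) → Fin N) :
    Fin (2 * n) → Fin N :=
  if x a = i ∧ x b = i then (fun c => if c = a ∨ c = b then j else x c) else x

/-- The exchange move `s^{ij}_{ab}`: if `x_a = i` and `x_b = j`, the two values are
exchanged; otherwise nothing happens. -/
def moveS {N n : ℕ} (i j : Fin N) (a b : Fin (2 * n)) (x : Fin (2 * n) → Fin N) :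
    Fin (2 * n) → Fin N :=
  if x a = i ∧ x b = j then (fun c => if c = a then j else if c = b then i else x c) else x

/-- The move part `𝓜_{ij}` of the colored eigenvector moment flow generator. -/
noncomputable def opM {N n : ℕ} (i j : Fin N) (f : (Fin (2 * n) → Fin N) → ℝ)
    (x : Fin (2 * n) → Fin N) : ℝ :=
  ((cnt x j + 1 : ℝ) / ((cnt x i : ℝ) - 1)) *
      ∑ a : Fin (2 * n), ∑ b ∈ Finset.univ.erase a, (f (moveM i j a b x) - f x) +
    ((cnt x i + 1 : ℝ) / ((cnt x j : ℝ) - 1)) *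
      ∑ a : Fin (2 * n), ∑ b ∈ Finset.univ.erase a, (f (moveM j i a b x) - f x)

/-- The exchange part `𝓔_{ij}` of the colored eigenvector moment flow generator. -/
noncomputable def opE {N n : ℕ} (i j : Fin N) (f : (Fin (2 * n) → Fin N) → ℝ)
    (x : Fin (2 * n) → Fin N) : ℝ :=
  ∑ a : Fin (2 * n), ∑ b ∈ Finset.univ.erase a, (f (moveS i j a b x) - f x)

/-- The generator `𝓛_{ij} = 𝓜_{ij} - 𝓔_{ij}` of the colored eigenvector moment flow. -/
noncomputable def opL {N n : ℕ} (i j : Fin N) (f : (Fin (2 * n) → Fin N) → ℝ)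
    (x : Fin (2 * n) → Fin N) : ℝ :=
  opM i j f x - opE i j f x

/-- The reversible measure `π(x) = ∏_i ((n_i(x)-1)!!)²` (with `(-1)!! = 1`). -/
def piMeas {N n : ℕ} (x : Fin (2 * n) → Fin N) : ℕ :=
  ∏ i : Fin N, (Nat.doubleFactorial (cnt x i - 1)) ^ 2

lemma cnt_update {N n : ℕ} (x : Fin (2 * n) → Fin N) (a : Fin (2 * n)) (v k : Fin N) :
    cnt (Function.update x a v) k + (if x a = k then 1 else 0)
      = cnt x k + (if v = k then 1 else 0) := by
  unfold cnt
  rw [Finset.card_filter, Finset.card_filter,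
    ← Finset.add_sum_erase univ _ (mem_univ a),
    ← Finset.add_sum_erase univ (fun c => if x c = k then 1 else 0) (mem_univ a)]
  have : ∑ c ∈ univ.erase a, (if Function.update x a v c = k then 1 else 0)
      = ∑ c ∈ univ.erase a, (if x c = k then 1 else 0) := by
    apply Finset.sum_congr rfl
    intro c hc
    rw [Function.update_of_ne (Finset.ne_of_mem_erase hc)]
  rw [this]
  simp only [Function.update_self]
  omega

lemma moveM_eq {N n : ℕ} (i j : Fin N) (a b : Fin (2 * n)) (x : Fin (2 * n) → Fin N)
    (h : x a = i ∧ x b = i) :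
    moveM i j a b x = Function.update (Function.update x a j) b j := by
  unfold moveM
  rw [if_pos h]
  funext c
  simp only [Function.update_apply]
  grind

lemma moveS_eq {N n : ℕ} (i j : Fin N) (a b : Fin (2 * n)) (hab : a ≠ b)
    (x : Fin (2 * n) → Fin N) (h : x a = i ∧ x b = j) :
    moveS i j a b x = Function.update (Function.update x a j) b i := by
  unfold moveS
  rw [if_pos h]
  funext c
  simp only [Function.update_apply]
  grind

lemma cnt_moveM {N n : ℕ} (i j : Fin N) (a b : Fin (2 * n)) (hab : a ≠ b)
    (x : Fin (2 * n) → Fin N) (h : x a = i ∧ x b = i) (k : Fin N) :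
    cnt (moveM i j a b x) k + (if i = k then 2 else 0)
      = cnt x k + (if j = k then 2 else 0) := by
  rw [moveM_eq i j a b x h]
  have h1 := cnt_update x a j k
  have h2 := cnt_update (Function.update x a j) b j k
  rw [Function.update_of_ne hab.symm] at h2
  rw [h.1] at h1
  rw [h.2] at h2
  split_ifs at * <;> omega

lemma cnt_moveS {N n : ℕ} (i j : Fin N) (a b : Fin (2 * n)) (hab : a ≠ b)
    (x : Fin (2 * n) → Fin N) (h : x a = i ∧ x b = j) (k : Fin N) :
    cnt (moveS i j a b x) k = cnt x k := by
  rw [moveS_eq i j a b hab x h]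
  have h1 := cnt_update x a j k
  have h2 := cnt_update (Function.update x a j) b i k
  rw [Function.update_of_ne hab.symm] at h2
  rw [h.1] at h1
  rw [h.2] at h2
  split_ifs at * <;> omega

lemma df_step (m : ℕ) : Nat.doubleFactorial (m + 2 - 1) = (m + 1) * Nat.doubleFactorial (m - 1) := by
  rcases m with _ | m
  · rfl
  · simpa using Nat.doubleFactorial_add_two m

lemma pi_moveM {N n : ℕ} (i j : Fin N) (hij : i ≠ j) (a b : Fin (2 * n)) (hab : a ≠ b)
    (x : Fin (2 * n) → Fin N) (h : x a = i ∧ x b = i) :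
    piMeas (moveM i j a b x) * (cnt (moveM i j a b x) i + 1) ^ 2
      = piMeas x * (cnt x j + 1) ^ 2 := by
  have hc := cnt_moveM i j a b hab x h
  set y := moveM i j a b x
  unfold piMeas
  have hj : j ∈ univ.erase i := by simp [hij.symm]
  rw [← Finset.mul_prod_erase univ _ (mem_univ i), ← Finset.mul_prod_erase _ _ hj,
    ← Finset.mul_prod_erase univ (fun k => (Nat.doubleFactorial (cnt x k - 1)) ^ 2) (mem_univ i),
    ← Finset.mul_prod_erase _ (fun k => (Nat.doubleFactorial (cnt x k - 1)) ^ 2) hj]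
  have hr : ∏ k ∈ (univ.erase i).erase j, (Nat.doubleFactorial (cnt y k - 1)) ^ 2
      = ∏ k ∈ (univ.erase i).erase j, (Nat.doubleFactorial (cnt x k - 1)) ^ 2 := by
    apply Finset.prod_congr rfl
    intro k hk
    have := hc k
    simp only [mem_erase] at hk
    rw [if_neg (Ne.symm hk.2.1), if_neg (Ne.symm hk.1)] at this
    simp only [add_zero] at this
    rw [this]
  rw [hr]
  have hi := hc i
  have hjj := hc j
  simp only [if_true, if_neg hij, if_neg hij.symm, add_zero] at hi hjj
  rw [← hi, hjj, df_step, df_step]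
  ring

lemma sum_eq_aux {X : Type*} (S : Finset X) (F G : X → ℝ) (φ ψ : X → X) (P Q : X → Prop)
    (hF : ∀ x, ¬ P x → F x = 0) (hG : ∀ x, ¬ Q x → G x = 0)
    (h1 : ∀ x ∈ S, P x → φ x ∈ S ∧ Q (φ x) ∧ ψ (φ x) = x ∧ F x = G (φ x))
    (h2 : ∀ x ∈ S, Q x → ψ x ∈ S ∧ P (ψ x) ∧ φ (ψ x) = x) :
    ∑ x ∈ S, F x = ∑ x ∈ S, G x := by
  classical
  have e1 : ∑ x ∈ S, F x = ∑ x ∈ S.filter P, F x := by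
    rw [Finset.sum_filter]
    exact Finset.sum_congr rfl fun x _ => by by_cases h : P x <;> simp [h, hF x]
  have e2 : ∑ x ∈ S, G x = ∑ x ∈ S.filter Q, G x := by
    rw [Finset.sum_filter]
    exact Finset.sum_congr rfl fun x _ => by by_cases h : Q x <;> simp [h, hG x]
  rw [e1, e2]
  refine Finset.sum_nbij' φ ψ ?_ ?_ ?_ ?_ ?_
  all_goals
    intro x hx
    rw [Finset.mem_filter] at hx
  · exact mem_filter.2 ⟨(h1 x hx.1 hx.2).1, (h1 x hx.1 hx.2).2.1⟩
  · exact mem_filter.2 ⟨(h2 x hx.1 hx.2).1, (h2 x hx.1 hx.2).2.1⟩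
  · exact (h1 x hx.1 hx.2).2.2.1
  · exact (h2 x hx.1 hx.2).2.2
  · exact (h1 x hx.1 hx.2).2.2.2

/-- even configurations -/
def evenConf (N n : ℕ) : Finset (Fin (2 * n) → Fin N) :=
  Finset.univ.filter (fun x : Fin (2 * n) → Fin N => ∀ k, Even (cnt x k))

lemma moveM_back {N n : ℕ} (i j : Fin N) (hij : i ≠ j) (a b : Fin (2 * n)) (hab : a ≠ b)
    (x : Fin (2 * n) → Fin N) (hx : x ∈ evenConf N n) (h : x a = i ∧ x b = i) :
    moveM i j a b x ∈ evenConf N n ∧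
      (moveM i j a b x a = j ∧ moveM i j a b x b = j) ∧
      moveM j i a b (moveM i j a b x) = x := by
  have h2 : moveM i j a b x a = j ∧ moveM i j a b x b = j := by
    unfold moveM
    rw [if_pos h]
    simp
  refine ⟨?_, h2, ?_⟩
  · unfold evenConf at hx ⊢
    simp only [mem_filter, mem_univ, true_and] at hx ⊢
    intro k
    have := cnt_moveM i j a b hab x h k
    have := hx k
    rw [Nat.even_iff] at *
    split_ifs at * <;> omega
  · rw [moveM_eq j i a b _ h2, moveM_eq i j a b x h]
    funext c
    simp only [Function.update_apply]
    grind

lemma moveS_back {N n : ℕ} (i j : Fin N) (a b : Fin (2 * n)) (hab : a ≠ b)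
    (x : Fin (2 * n) → Fin N) (hx : x ∈ evenConf N n) (h : x a = i ∧ x b = j) :
    moveS i j a b x ∈ evenConf N n ∧
      (moveS i j a b x b = i ∧ moveS i j a b x a = j) ∧
      moveS i j b a (moveS i j a b x) = x := by
  have h2 : moveS i j a b x b = i ∧ moveS i j a b x a = j := by
    unfold moveS
    rw [if_pos h]
    simp [hab.symm]
  refine ⟨?_, h2, ?_⟩
  · unfold evenConf at hx ⊢
    simp only [mem_filter, mem_univ, true_and] at hx ⊢
    intro k
    rw [cnt_moveS i j a b hab x h k]
    exact hx k
  · rw [moveS_eq i j b a hab.symm _ h2, moveS_eq i j a b hab x h]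
    funext c
    simp only [Function.update_apply]
    grind

/-- weights of the merge moves -/
noncomputable def wgt {N n : ℕ} (i j : Fin N) (x : Fin (2 * n) → Fin N) : ℝ :=
  (piMeas x : ℝ) * ((cnt x j + 1 : ℝ) / ((cnt x i : ℝ) - 1))

lemma wgt_moveM {N n : ℕ} (i j : Fin N) (hij : i ≠ j) (a b : Fin (2 * n)) (hab : a ≠ b)
    (x : Fin (2 * n) → Fin N) (h : x a = i ∧ x b = i) :
    wgt j i (moveM i j a b x) = wgt i j x := by
  have hp := pi_moveM i j hij a b hab x h
  have hi := cnt_moveM i j a b hab x h i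
  have hj := cnt_moveM i j a b hab x h j
  simp only [if_true, if_neg hij, if_neg hij.symm, add_zero] at hi hj
  unfold wgt
  set y := moveM i j a b x
  rw [← hi, hj]
  have hp' : (piMeas y : ℝ) * ((cnt y i : ℝ) + 1) ^ 2 = piMeas x * ((cnt x j : ℝ) + 1) ^ 2 := by
    exact_mod_cast hp
  have p1 : (cnt y i : ℝ) + 1 ≠ 0 := by positivity
  have p2 : (cnt x j : ℝ) + 1 ≠ 0 := by positivity
  push_cast
  have q1 : (cnt y i : ℝ) + 2 - 1 = cnt y i + 1 := by ring
  have q2 : (cnt x j : ℝ) + 2 - 1 = cnt x j + 1 := by ring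
  rw [q1, q2]
  field_simp
  linarith

lemma sum_M {N n : ℕ} (i j : Fin N) (hij : i ≠ j) (a b : Fin (2 * n)) (hab : a ≠ b)
    (f g : (Fin (2 * n) → Fin N) → ℝ) :
    ∑ x ∈ evenConf N n, wgt i j x * (f x * g (moveM i j a b x) - f (moveM i j a b x) * g x)
      = ∑ x ∈ evenConf N n,
        wgt j i x * (f (moveM j i a b x) * g x - f x * g (moveM j i a b x)) := by
  refine sum_eq_aux _ _ _ (moveM i j a b) (moveM j i a b)
    (fun x => x a = i ∧ x b = i) (fun x => x a = j ∧ x b = j) ?_ ?_ ?_ ?_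
  · intro x hx
    have : moveM i j a b x = x := by unfold moveM; rw [if_neg hx]
    rw [this]; ring
  · intro x hx
    have : moveM j i a b x = x := by unfold moveM; rw [if_neg hx]
    rw [this]; ring
  · intro x hx h
    obtain ⟨h1, h2, h3⟩ := moveM_back i j hij a b hab x hx h
    refine ⟨h1, h2, h3, ?_⟩
    rw [h3, wgt_moveM i j hij a b hab x h]
  · intro x hx h
    exact moveM_back j i hij.symm a b hab x hx h

lemma sum_S {N n : ℕ} (i j : Fin N) (a b : Fin (2 * n)) (hab : a ≠ b)
    (f g : (Fin (2 * n) → Fin N) → ℝ) :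
    ∑ x ∈ evenConf N n,
        (piMeas x : ℝ) * (f x * g (moveS i j a b x) - f (moveS i j a b x) * g x)
      = ∑ x ∈ evenConf N n,
        (piMeas x : ℝ) * (f (moveS i j b a x) * g x - f x * g (moveS i j b a x)) := by
  refine sum_eq_aux _ _ _ (moveS i j a b) (moveS i j b a)
    (fun x => x a = i ∧ x b = j) (fun x => x b = i ∧ x a = j) ?_ ?_ ?_ ?_
  · intro x hx
    have : moveS i j a b x = x := by unfold moveS; rw [if_neg hx]
    rw [this]; ring
  · intro x hx
    have : moveS i j b a x = x := by unfold moveS; rw [if_neg hx]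
    rw [this]; ring
  · intro x hx h
    obtain ⟨h1, h2, h3⟩ := moveS_back i j a b hab x hx h
    refine ⟨h1, h2, h3, ?_⟩
    have : piMeas (moveS i j a b x) = piMeas x := by
      unfold piMeas
      simp only [cnt_moveS i j a b hab x h]
    rw [h3, this]
  · intro x hx h
    exact moveS_back i j b a hab.symm x hx h

/-- the set of ordered pairs -/
def prs (n : ℕ) : Finset (Fin (2 * n) × Fin (2 * n)) :=
  Finset.univ.filter (fun p => p.1 ≠ p.2)

lemma sum_prs {n : ℕ} (F : Fin (2 * n) → Fin (2 * n) → ℝ) :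
    ∑ a : Fin (2 * n), ∑ b ∈ Finset.univ.erase a, F a b = ∑ p ∈ prs n, F p.1 p.2 := by
  unfold prs
  rw [Finset.sum_filter, Fintype.sum_prod_type]
  refine Finset.sum_congr rfl fun a _ => ?_
  rw [← Finset.sum_filter]
  refine Finset.sum_congr ?_ fun _ _ => rfl
  ext b
  simp [eq_comm]

/-- The measure `π` is reversible for the colored eigenvector moment flow: each `𝓛_{ij}` is
self-adjoint with respect to `⟨f,g⟩_π = Σ_{x∈Λⁿ} π(x) f(x) g(x)`. -/
theorem opL_reversible {N n : ℕ} (hN : 2 ≤ N) (hn : 1 ≤ n)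
    (i j : Fin N) (hij : i < j) (f g : (Fin (2 * n) → Fin N) → ℝ) :
    ∑ x ∈ Finset.univ.filter (fun x : Fin (2 * n) → Fin N => ∀ k, Even (cnt x k)),
        (piMeas x : ℝ) * f x * opL i j g x =
      ∑ x ∈ Finset.univ.filter (fun x : Fin (2 * n) → Fin N => ∀ k, Even (cnt x k)),
        (piMeas x : ℝ) * opL i j f x * g x := by
  change ∑ x ∈ evenConf N n, _ = ∑ x ∈ evenConf N n, _
  have hne : i ≠ j := ne_of_lt hij
  have key : ∀ x : Fin (2 * n) → Fin N,
      (piMeas x : ℝ) * f x * opL i j g x - (piMeas x : ℝ) * opL i j f x * g x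
      = ∑ p ∈ prs n,
        (wgt i j x * (f x * g (moveM i j p.1 p.2 x) - f (moveM i j p.1 p.2 x) * g x)
        - wgt j i x * (f (moveM j i p.1 p.2 x) * g x - f x * g (moveM j i p.1 p.2 x))
        - (piMeas x : ℝ) *
          (f x * g (moveS i j p.1 p.2 x) - f (moveS i j p.1 p.2 x) * g x)) := by
    intro x
    unfold opL opM opE wgt
    simp only [sum_prs]
    simp only [Finset.sum_sub_distrib, ← Finset.mul_sum, ← Finset.sum_mul, Finset.sum_const, nsmul_eq_mul]
    ring
  rw [← sub_eq_zero, ← Finset.sum_sub_distrib, Finset.sum_congr rfl fun x _ => key x,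
    Finset.sum_comm]
  simp only [Finset.sum_sub_distrib (s := evenConf N n)]
  rw [Finset.sum_sub_distrib, Finset.sum_eq_zero (s := prs n), zero_sub, neg_eq_zero]
  · set T : Fin (2 * n) × Fin (2 * n) → ℝ := fun p => ∑ x ∈ evenConf N n,
      (piMeas x : ℝ) * (f x * g (moveS i j p.1 p.2 x) - f (moveS i j p.1 p.2 x) * g x) with hT
    have e1 : ∑ p ∈ prs n, T p = ∑ p ∈ prs n, - T p.swap := by
      refine Finset.sum_congr rfl fun p hp => ?_
      have hp' : p.1 ≠ p.2 := by simpa [prs] using hp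
      simp only [hT]
      rw [sum_S i j p.1 p.2 hp' f g, ← Finset.sum_neg_distrib]
      refine Finset.sum_congr rfl fun x _ => ?_
      simp only [Prod.fst_swap, Prod.snd_swap]
      ring
    have e2 : ∑ p ∈ prs n, T p.swap = ∑ p ∈ prs n, T p := by
      refine Finset.sum_nbij' Prod.swap Prod.swap ?_ ?_ ?_ ?_ ?_
      · intro p hp
        simpa [prs, eq_comm] using hp
      · intro p hp
        simpa [prs, eq_comm] using hp
      · simp
      · simp
      · simp
    rw [Finset.sum_neg_distrib, e2] at e1
    change ∑ p ∈ prs n, T p = 0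
    linarith
  · intro p hp
    have hp' : p.1 ≠ p.2 := by simpa [prs] using hp
    have := sum_M i j hne p.1 p.2 hp' f g
    simp only [← Finset.sum_sub_distrib] at this ⊢
    rw [← sub_eq_zero, ← Finset.sum_sub_distrib] at this
    exact this
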